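/- Suppose μ₂ = 0. Then for every j ∈ ℕ the limit p_j := lim_{t→∞} P(d(V_t) = j) exists; moreover p_0 = 0 and, for every j ≥ 1, p_j = (λ₁/λ₂)·B(j, 1 + λ₁/λ₂). -/

import Mathlib

open Filter Topology MeasureTheory

/-- The Beta function `B(a,b) = ∫₀¹ s^(a-1) (1-s)^(b-1) ds`. -/
noncomputable def betaFn (a b : ℝ) : ℝ :=
  ∫ s in (0:ℝ)..1, s ^ (a - 1) * (1 - s) ^ (b - 1)

/-- One-step transition probability of the preferential attachment–detachment
in-degree chain on nonempty finite sequences of naturals (encoded as lists):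
from a state `x`, the `i`-th entry is increased by `1` with probability
`xⁱλ₂ / ((λ₂+μ₂)‖x‖ + ℓ(x)λ₁)`, decreased by `1` with probability
`xⁱμ₂ / ((λ₂+μ₂)‖x‖ + ℓ(x)λ₁)`, and an entry `1` is appended with probability
`ℓ(x)λ₁ / ((λ₂+μ₂)‖x‖ + ℓ(x)λ₁)`. -/
noncomputable def stepProb (lam1 lam2 mu2 : ℝ) (x y : List ℕ) : ℝ :=
  ((∑ i ∈ Finset.range x.length,
      (x.getD i 0 : ℝ) * lam2 * (if y = x.set i (x.getD i 0 + 1) then 1 else 0)) +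
   (∑ i ∈ Finset.range x.length,
      (x.getD i 0 : ℝ) * mu2 * (if y = x.set i (x.getD i 0 - 1) then 1 else 0)) +
   (x.length : ℝ) * lam1 * (if y = x ++ [1] then 1 else 0)) /
    ((lam2 + mu2) * (x.sum : ℝ) + (x.length : ℝ) * lam1)

/-- Distribution at time `t` of the Markov chain `d = (d_t)` started at the
length-one sequence `(1)`. -/
noncomputable def chainDist (lam1 lam2 mu2 : ℝ) : ℕ → List ℕ → ℝ
  | 0 => fun x => if x = [1] then 1 else 0
  | (t + 1) => fun y => ∑' x : List ℕ, chainDist lam1 lam2 mu2 t x * stepProb lam1 lam2 mu2 x y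

/-- `P(d(V_t) = j) = E[ ℓ(d_t)⁻¹ ∑_{i=1}^{ℓ(d_t)} 1{d_tⁱ = j} ]`, the in-degree
distribution of a vertex chosen uniformly at random at time `t`. -/
noncomputable def inDegProb (lam1 lam2 mu2 : ℝ) (t j : ℕ) : ℝ :=
  ∑' x : List ℕ, chainDist lam1 lam2 mu2 t x * ((x.count j : ℝ) / (x.length : ℝ))

/-! ### The Beta function -/

theorem betaFn_eq_beta {a b : ℝ} (ha : 0 < a) (hb : 0 < b) :
    betaFn a b = ProbabilityTheory.beta a b := by
  rw [ProbabilityTheory.beta_eq_betaIntegralReal a b ha hb, Complex.betaIntegral, betaFn]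
  have h : ∀ s ∈ Set.uIcc (0 : ℝ) 1,
      (s : ℂ) ^ ((a : ℂ) - 1) * (1 - (s : ℂ)) ^ ((b : ℂ) - 1) =
        ((s ^ (a - 1) * (1 - s) ^ (b - 1) : ℝ) : ℂ) := by
    intro s hs
    rw [Set.uIcc_of_le zero_le_one] at hs
    rw [Complex.ofReal_mul, Complex.ofReal_cpow hs.1, Complex.ofReal_cpow (by linarith [hs.2])]
    push_cast
    rfl
  rw [intervalIntegral.integral_congr h, intervalIntegral.integral_ofReal, Complex.ofReal_re]

theorem betaFn_one {b : ℝ} (hb : 0 < b) : b * betaFn 1 b = 1 := by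
  rw [betaFn_eq_beta one_pos hb, ProbabilityTheory.beta, add_comm, Real.Gamma_add_one hb.ne',
    Real.Gamma_one]
  have := (Real.Gamma_pos_of_pos hb).ne'
  field_simp

theorem betaFn_add_one {a b : ℝ} (ha : 0 < a) (hb : 0 < b) :
    (a + b) * betaFn (a + 1) b = a * betaFn a b := by
  rw [betaFn_eq_beta (by positivity) hb, betaFn_eq_beta ha hb, ProbabilityTheory.beta,
    ProbabilityTheory.beta, add_right_comm, Real.Gamma_add_one ha.ne',
    Real.Gamma_add_one (by positivity)]
  have := (Real.Gamma_pos_of_pos (add_pos ha hb)).ne'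
  field_simp

/-! ### A recursive inequality -/

theorem tendsto_zero_of_harmonic_contraction {u ε : ℕ → ℝ} {c : ℝ} (hc : 0 < c) (hc1 : c ≤ 1)
    (hu : ∀ t, 0 ≤ u t) (hε : Tendsto ε atTop (𝓝 0))
    (h : ∀ t : ℕ, u (t + 1) ≤ (1 - c / ((t : ℝ) + 1)) * u t + ε t / ((t : ℝ) + 1)) :
    Tendsto u atTop (𝓝 0) := by
  set H : ℕ → ℝ := fun t => ∑ i ∈ Finset.range t, 1 / ((i : ℝ) + 1) with hH
  have hHt : Tendsto H atTop atTop := Real.tendsto_sum_range_one_div_nat_succ_atTop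
  rw [Metric.tendsto_atTop]
  intro δ hδ
  obtain ⟨T, hT⟩ := eventually_atTop.1 (hε.eventually_lt_const (show 0 < c * (δ / 2) by positivity))
  set M := u T * Real.exp (c * H T) with hM
  have hM0 : 0 ≤ M := mul_nonneg (hu T) (Real.exp_pos _).le
  have key : ∀ t, T ≤ t → u t - δ / 2 ≤ M * Real.exp (-(c * H t)) := by
    intro t ht
    induction t, ht using Nat.le_induction with
    | base =>
      rw [hM, mul_assoc, ← Real.exp_add, add_neg_cancel, Real.exp_zero, mul_one]
      linarith
    | succ t ht ih =>
      have hpos : (0 : ℝ) < (t : ℝ) + 1 := by positivity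
      have h0 : 0 ≤ 1 - c / ((t : ℝ) + 1) := by
        rw [sub_nonneg, div_le_one hpos]
        have : (0 : ℝ) ≤ t := t.cast_nonneg
        linarith
      have h1 : ε t / ((t : ℝ) + 1) ≤ c / ((t : ℝ) + 1) * (δ / 2) := by
        rw [div_mul_eq_mul_div]
        exact div_le_div_of_nonneg_right (hT t ht).le hpos.le
      have h2 : 1 - c / ((t : ℝ) + 1) ≤ Real.exp (-(c / ((t : ℝ) + 1))) := by
        linarith [Real.add_one_le_exp (-(c / ((t : ℝ) + 1)))]
      have hexp : Real.exp (-(c * H (t + 1))) =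
          Real.exp (-(c / ((t : ℝ) + 1))) * Real.exp (-(c * H t)) := by
        rw [← Real.exp_add, hH]
        simp only [Finset.sum_range_succ]
        congr 1
        ring
      calc u (t + 1) - δ / 2 ≤ (1 - c / ((t : ℝ) + 1)) * (u t - δ / 2) := by linarith [h t]
        _ ≤ (1 - c / ((t : ℝ) + 1)) * (M * Real.exp (-(c * H t))) := by gcongr
        _ ≤ Real.exp (-(c / ((t : ℝ) + 1))) * (M * Real.exp (-(c * H t))) := by gcongr
        _ = M * Real.exp (-(c * H (t + 1))) := by rw [hexp]; ring
  have hlim : Tendsto (fun t => M * Real.exp (-(c * H t))) atTop (𝓝 0) := by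
    have := (Real.tendsto_exp_neg_atTop_nhds_zero.comp (hHt.const_mul_atTop hc)).const_mul M
    simpa using this
  obtain ⟨T', hT'⟩ := eventually_atTop.1 (hlim.eventually_lt_const (half_pos hδ))
  refine ⟨max T T', fun t ht => ?_⟩
  rw [Real.dist_eq, sub_zero, abs_of_nonneg (hu t)]
  linarith [key t (le_of_max_le_left ht), hT' t (le_of_max_le_right ht)]

/-! ### Expectations along the chain without detachment -/

/-- The conditional expectation of `f` after one step of the chain without detachment. -/
noncomputable def stepMean (a b : ℝ) (f : List ℕ → ℝ) (x : List ℕ) : ℝ :=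
  ((∑ i ∈ Finset.range x.length, (x.getD i 0 : ℝ) * b * f (x.set i (x.getD i 0 + 1))) +
    (x.length : ℝ) * a * f (x ++ [1])) / (b * (x.sum : ℝ) + (x.length : ℝ) * a)

/-- The expectation of `f` at time `t` for the chain without detachment. -/
noncomputable def chainMean (a b : ℝ) : ℕ → (List ℕ → ℝ) → ℝ
  | 0, f => f [1]
  | t + 1, f => chainMean a b t (stepMean a b f)

/-- The states that are reachable at time `t` by the chain without detachment. -/
structure IsReachable (t : ℕ) (x : List ℕ) : Prop where
  length_pos : 0 < x.length
  sum_eq : x.sum = t + 1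
  one_le : ∀ m ∈ x, 1 ≤ m

theorem hasSum_stepProb_mul (a b : ℝ) (f : List ℕ → ℝ) (x : List ℕ) :
    HasSum (fun y => stepProb a b 0 x y * f y) (stepMean a b f x) := by
  have hite : ∀ (w : ℝ) (z : List ℕ),
      HasSum (fun y => w * (if y = z then 1 else 0) * f y) (w * f z) := by
    intro w z
    convert hasSum_ite_eq z (w * f z) using 2 with y
    split_ifs with h <;> simp [h]
  have h := ((hasSum_sum (s := Finset.range x.length) fun i _ =>
    hite ((x.getD i 0 : ℝ) * b) (x.set i (x.getD i 0 + 1))).add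
      (hite ((x.length : ℝ) * a) (x ++ [1]))).div_const (b * (x.sum : ℝ) + (x.length : ℝ) * a)
  refine h.congr_fun ?_
  intro y
  simp only [stepProb, mul_zero, zero_mul, Finset.sum_const_zero, add_zero, ← Finset.sum_mul]
  ring

theorem finite_support_stepProb (a b : ℝ) (x : List ℕ) :
    (Function.support (stepProb a b 0 x)).Finite := by
  refine (Finset.finite_toSet (insert (x ++ [1])
    ((Finset.range x.length).image fun i => x.set i (x.getD i 0 + 1)))).subset ?_
  intro y hy
  by_contra hmem
  simp only [Finset.coe_insert, Finset.coe_image, Set.mem_insert_iff, Set.mem_image, not_or,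
    not_exists, not_and] at hmem
  refine hy ?_
  have h : ∀ i ∈ Finset.range x.length,
      (x.getD i 0 : ℝ) * b * (if y = x.set i (x.getD i 0 + 1) then 1 else 0) = 0 := fun i hi => by
    rw [if_neg fun h => hmem.2 i hi h.symm, mul_zero]
  rw [stepProb, Finset.sum_eq_zero h, if_neg hmem.1]
  simp

theorem finite_support_chainDist (a b : ℝ) (t : ℕ) :
    (Function.support (chainDist a b 0 t)).Finite := by
  induction t with
  | zero =>
    refine (Set.finite_singleton [1]).subset fun x hx => ?_
    by_contra h
    exact hx (if_neg h)
  | succ t ih =>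
    refine (ih.biUnion fun x _ => finite_support_stepProb a b x).subset fun y hy => ?_
    by_contra h
    simp only [Set.mem_iUnion, Function.mem_support, not_exists] at h
    refine hy ?_
    rw [chainDist]
    refine (tsum_congr fun x => ?_).trans tsum_zero
    by_cases hx : chainDist a b 0 t x = 0
    · rw [hx, zero_mul]
    · rw [not_not.1 (h x hx), mul_zero]

theorem hasSum_chainDist_mul (a b : ℝ) (t : ℕ) (f : List ℕ → ℝ) :
    HasSum (fun x => chainDist a b 0 t x * f x) (chainMean a b t f) := by
  induction t generalizing f with
  | zero =>
    refine (hasSum_ite_eq [1] (f [1])).congr_fun fun x => ?_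
    rw [chainDist]
    split_ifs with h <;> simp [h]
  | succ t ih =>
    set s := (finite_support_chainDist a b t).toFinset with hs
    have hzero : ∀ x ∉ s, chainDist a b 0 t x = 0 := fun x hx => by simpa [hs] using hx
    have hsum : ∀ g : List ℕ → ℝ,
        ∑' x, chainDist a b 0 t x * g x = ∑ x ∈ s, chainDist a b 0 t x * g x := fun g =>
      tsum_eq_sum fun x hx => by rw [hzero x hx, zero_mul]
    rw [chainMean, ← (ih (stepMean a b f)).tsum_eq, hsum]
    refine (hasSum_sum fun x _ =>
      (hasSum_stepProb_mul a b f x).mul_left (chainDist a b 0 t x)).congr_fun fun y => ?_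
    simp only [chainDist, hsum, Finset.sum_mul]
    exact Finset.sum_congr rfl fun x _ => by ring

theorem inDegProb_eq_chainMean (a b : ℝ) (t j : ℕ) :
    inDegProb a b 0 t j = chainMean a b t fun x => (x.count j : ℝ) / x.length :=
  (hasSum_chainDist_mul a b t _).tsum_eq

theorem stepMean_add (a b : ℝ) (f g : List ℕ → ℝ) :
    stepMean a b (fun x => f x + g x) = fun x => stepMean a b f x + stepMean a b g x := by
  ext x
  simp only [stepMean, mul_add, Finset.sum_add_distrib]
  ring

theorem stepMean_const_mul (a b w : ℝ) (f : List ℕ → ℝ) :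
    stepMean a b (fun x => w * f x) = fun x => w * stepMean a b f x := by
  ext x
  simp only [stepMean, mul_left_comm _ w, ← Finset.mul_sum]
  ring

theorem chainMean_add (a b : ℝ) (t : ℕ) (f g : List ℕ → ℝ) :
    chainMean a b t (fun x => f x + g x) = chainMean a b t f + chainMean a b t g := by
  induction t generalizing f g with
  | zero => rfl
  | succ t ih => simp only [chainMean, stepMean_add, ih]

theorem chainMean_const_mul (a b w : ℝ) (t : ℕ) (f : List ℕ → ℝ) :
    chainMean a b t (fun x => w * f x) = w * chainMean a b t f := by
  induction t generalizing f with
  | zero => rfl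
  | succ t ih => simp only [chainMean, stepMean_const_mul, ih]

theorem sum_range_getD (x : List ℕ) (g : ℕ → ℝ) :
    ∑ i ∈ Finset.range x.length, g (x.getD i 0) = (x.map g).sum := by
  induction x with
  | nil => simp
  | cons m x ih =>
    rw [List.length_cons, Finset.sum_range_succ', List.map_cons, List.sum_cons, ← ih, add_comm]
    rfl

theorem sum_range_getD_cast (x : List ℕ) :
    ∑ i ∈ Finset.range x.length, (x.getD i 0 : ℝ) = x.sum := by
  rw [sum_range_getD x fun m => (m : ℝ), Nat.cast_list_sum]

theorem sum_range_getD_indicator (x : List ℕ) (k : ℕ) :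
    ∑ i ∈ Finset.range x.length, (x.getD i 0 : ℝ) * (if x.getD i 0 = k then 1 else 0) =
      k * x.count k := by
  rw [sum_range_getD x fun m => (m : ℝ) * (if m = k then 1 else 0)]
  induction x with
  | nil => simp
  | cons m x ih =>
    rw [List.map_cons, List.sum_cons, ih, List.count_cons]
    by_cases h : m = k
    · simp [h]; ring
    · simp [h]

theorem sum_set_succ (x : List ℕ) {i : ℕ} (hi : i < x.length) :
    (x.set i (x.getD i 0 + 1)).sum = x.sum + 1 := by
  induction x generalizing i with
  | nil => simp at hi
  | cons m x ih =>
    cases i with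
    | zero => simp; omega
    | succ i =>
      have := ih (i := i) (by simpa using hi)
      simp only [List.getD_cons_succ, List.set_cons_succ, List.sum_cons, this]
      omega

theorem count_set_succ (x : List ℕ) {i : ℕ} (hi : i < x.length) (k : ℕ) :
    ((x.set i (x.getD i 0 + 1)).count (k + 1) : ℝ) =
      x.count (k + 1) + (if x.getD i 0 = k then 1 else 0) -
        (if x.getD i 0 = k + 1 then 1 else 0) := by
  induction x generalizing i with
  | nil => simp at hi
  | cons m x ih =>
    cases i with
    | zero =>
      simp only [List.getD_cons_zero, List.set_cons_zero, List.count_cons, beq_iff_eq,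
        add_left_inj]
      push_cast
      ring
    | succ i =>
      have := ih (i := i) (by simpa using hi)
      simp only [List.getD_cons_succ, List.set_cons_succ, List.count_cons]
      push_cast
      rw [this]
      ring

namespace IsReachable

variable {t : ℕ} {x : List ℕ}

theorem set_succ (hx : IsReachable t x) {i : ℕ} (hi : i < x.length) :
    IsReachable (t + 1) (x.set i (x.getD i 0 + 1)) where
  length_pos := by simpa using hx.length_pos
  sum_eq := by rw [sum_set_succ x hi, hx.sum_eq]
  one_le m hm := by
    rcases List.mem_or_eq_of_mem_set hm with h | h
    · exact hx.one_le m h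
    · omega

theorem append_one (hx : IsReachable t x) : IsReachable (t + 1) (x ++ [1]) where
  length_pos := by simp
  sum_eq := by simp [hx.sum_eq]
  one_le m hm := by
    rcases List.mem_append.1 hm with h | h
    · exact hx.one_le m h
    · simp_all

theorem length_le (hx : IsReachable t x) : x.length ≤ t + 1 := by
  rw [← hx.sum_eq]
  simpa using List.card_nsmul_le_sum x 1 hx.one_le

theorem count_zero (hx : IsReachable t x) : x.count 0 = 0 :=
  List.count_eq_zero.2 fun h => absurd (hx.one_le 0 h) (by norm_num)

end IsReachable

theorem isReachable_singleton : IsReachable 0 [1] := ⟨by simp, by simp, by simp⟩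


theorem stepMean_le {a b : ℝ} (ha : 0 ≤ a) (hb : 0 ≤ b) {t : ℕ} {x : List ℕ} (hx : IsReachable t x)
    {f g : List ℕ → ℝ} (h : ∀ y, IsReachable (t + 1) y → f y ≤ g y) :
    stepMean a b f x ≤ stepMean a b g x := by
  unfold stepMean
  gcongr with i hi
  · exact h _ (hx.set_succ (Finset.mem_range.1 hi))
  · exact h _ hx.append_one

theorem chainMean_le {a b : ℝ} (ha : 0 ≤ a) (hb : 0 ≤ b) {t : ℕ} {f g : List ℕ → ℝ}
    (h : ∀ x, IsReachable t x → f x ≤ g x) : chainMean a b t f ≤ chainMean a b t g := by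
  induction t generalizing f g with
  | zero => exact h _ isReachable_singleton
  | succ t ih => exact ih fun x hx => stepMean_le ha hb hx h

theorem chainMean_congr {a b : ℝ} (ha : 0 ≤ a) (hb : 0 ≤ b) {t : ℕ} {f g : List ℕ → ℝ}
    (h : ∀ x, IsReachable t x → f x = g x) : chainMean a b t f = chainMean a b t g :=
  (chainMean_le ha hb fun x hx => (h x hx).le).antisymm
    (chainMean_le ha hb fun x hx => (h x hx).ge)

theorem stepMean_const {a b : ℝ} (ha : 0 < a) (hb : 0 ≤ b) {t : ℕ} {x : List ℕ}
    (hx : IsReachable t x) (w : ℝ) : stepMean a b (fun _ => w) x = w := by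
  have hL : (0 : ℝ) < x.length := by exact_mod_cast hx.length_pos
  have hD : b * (x.sum : ℝ) + x.length * a ≠ 0 := by positivity
  rw [stepMean, ← Finset.sum_mul, ← Finset.sum_mul, sum_range_getD_cast, div_eq_iff hD]
  ring

theorem chainMean_const {a b : ℝ} (ha : 0 < a) (hb : 0 ≤ b) (t : ℕ) (w : ℝ) :
    chainMean a b t (fun _ => w) = w := by
  induction t with
  | zero => rfl
  | succ t ih =>
    rw [chainMean, chainMean_congr ha.le hb fun x hx => stepMean_const ha hb hx w, ih]

theorem chainMean_nonneg {a b : ℝ} (ha : 0 < a) (hb : 0 ≤ b) {t : ℕ} {f : List ℕ → ℝ}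
    (h : ∀ x, IsReachable t x → 0 ≤ f x) : 0 ≤ chainMean a b t f :=
  (chainMean_const ha hb t 0).symm.trans_le (chainMean_le ha.le hb h)

theorem sq_chainMean_le {a b : ℝ} (ha : 0 < a) (hb : 0 ≤ b) (t : ℕ) (f : List ℕ → ℝ) :
    chainMean a b t f ^ 2 ≤ chainMean a b t fun x => f x ^ 2 := by
  set m := chainMean a b t f with hm
  have h : chainMean a b t (fun x => 2 * m * f x + -m ^ 2) ≤ chainMean a b t fun x => f x ^ 2 :=
    chainMean_le ha.le hb fun x _ => by nlinarith [sq_nonneg (f x - m)]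
  rw [chainMean_add, chainMean_const_mul, chainMean_const ha hb, ← hm] at h
  linarith

/-! ### Drift estimates -/

/-- The squared deviation from `p` of the proportion of entries equal to `j`. -/
noncomputable def sqDev (j : ℕ) (p : ℝ) (x : List ℕ) : ℝ :=
  ((x.count j : ℝ) / x.length - p) ^ 2

theorem sqDev_nonneg (j : ℕ) (p : ℝ) (x : List ℕ) : 0 ≤ sqDev j p x := sq_nonneg _

theorem stepMean_inv_length_le {a b : ℝ} (ha : 0 < a) (hb : 0 < b) {t : ℕ} {x : List ℕ}
    (hx : IsReachable t x) :
    stepMean a b (fun y => (y.length : ℝ)⁻¹) x ≤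
      (1 - a / (2 * (a + b)) / ((t : ℝ) + 1)) * (x.length : ℝ)⁻¹ := by
  have hL : (1 : ℝ) ≤ x.length := by exact_mod_cast hx.length_pos
  have hLS : (x.length : ℝ) ≤ t + 1 := by exact_mod_cast hx.length_le
  have hS : (x.sum : ℝ) = t + 1 := by exact_mod_cast hx.sum_eq
  simp only [stepMean, List.length_set, List.length_append, List.length_cons, List.length_nil,
    ← Finset.sum_mul, sum_range_getD_cast, hS]
  push_cast
  generalize (x.length : ℝ) = L at *
  generalize (t : ℝ) + 1 = S at *
  have hS0 : 0 < S := by linarith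
  have hL0 : 0 < L := by linarith
  have hD : 0 < b * S + L * a := by positivity
  have h1 : (S * b * L⁻¹ + L * a * (L + 1)⁻¹) / (b * S + L * a) =
      L⁻¹ - a / ((L + 1) * (b * S + L * a)) := by
    field_simp
    ring
  have h2 : a / (2 * (a + b)) / S * L⁻¹ ≤ a / ((L + 1) * (b * S + L * a)) := by
    rw [div_div, ← div_eq_mul_inv, div_div]
    gcongr a / ?_
    calc (L + 1) * (b * S + L * a) ≤ (2 * L) * (b * S + S * a) := by gcongr; linarith
      _ = 2 * (a + b) * S * L := by ring
  rw [h1]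
  linarith

theorem stepMean_sqDev_eq (a b : ℝ) {t : ℕ} {x : List ℕ}
    (hx : IsReachable t x) (k : ℕ) (r : ℝ) :
    stepMean a b (sqDev (k + 1) r) x =
      (b * ((t + 1) * sqDev (k + 1) r x +
        (2 * ((x.count (k + 1) : ℝ) / x.length - r) / x.length + 1 / (x.length : ℝ) ^ 2) *
          (k * x.count k) +
        (-2 * ((x.count (k + 1) : ℝ) / x.length - r) / x.length + 1 / (x.length : ℝ) ^ 2) *
          ((k + 1) * x.count (k + 1))) +
        x.length * a * (((x.count (k + 1) : ℝ) + if k = 0 then 1 else 0) / (x.length + 1) - r) ^ 2)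
        / (b * (t + 1) + x.length * a) := by
  have hS : (x.sum : ℝ) = t + 1 := by exact_mod_cast hx.sum_eq
  have hset : ∀ i ∈ Finset.range x.length,
      (x.getD i 0 : ℝ) * b * sqDev (k + 1) r (x.set i (x.getD i 0 + 1)) =
        b * (x.getD i 0 * sqDev (k + 1) r x +
        (2 * ((x.count (k + 1) : ℝ) / x.length - r) / x.length + 1 / (x.length : ℝ) ^ 2) *
          (x.getD i 0 * if x.getD i 0 = k then 1 else 0) +
        (-2 * ((x.count (k + 1) : ℝ) / x.length - r) / x.length + 1 / (x.length : ℝ) ^ 2) *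
          (x.getD i 0 * if x.getD i 0 = k + 1 then 1 else 0)) := fun i hi => by
    rw [sqDev, count_set_succ x (Finset.mem_range.1 hi), List.length_set, sqDev]
    generalize x.getD i 0 = m
    by_cases h1 : m = k
    · have h2 : m ≠ k + 1 := by omega
      simp only [if_pos h1, if_neg h2]
      ring
    · by_cases h2 : m = k + 1
      · simp only [if_neg h1, if_pos h2]
        ring
      · simp only [if_neg h1, if_neg h2]
        ring
  rw [stepMean, Finset.sum_congr rfl hset, ← Finset.mul_sum, Finset.sum_add_distrib,
    Finset.sum_add_distrib, ← Finset.sum_mul, ← Finset.mul_sum, ← Finset.mul_sum,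
    sum_range_getD_cast, sum_range_getD_indicator, sum_range_getD_indicator, hS]
  congr 3
  · push_cast
    ring
  · rw [sqDev, List.count_append, List.count_singleton]
    rcases k with _ | k <;> simp

theorem sq_drift_eq {a b κ e q r L S X Z : ℝ} (hL : 0 < L)
    (hqr : ((κ + 1) * b + a) * r = κ * b * q + a * e) :
    b * (S * (X - r) ^ 2 + (2 * (X - r) / L + 1 / L ^ 2) * (κ * (Z * L)) +
        (-2 * (X - r) / L + 1 / L ^ 2) * ((κ + 1) * (X * L))) +
        L * a * ((X * L + e) / (L + 1) - r) ^ 2 =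
      (b * S + L * a) * (X - r) ^ 2 +
        2 * (X - r) * (b * κ * (Z - q) - (b * (κ + 1) + a) * (X - r)) +
        (b * ((κ * Z + (κ + 1) * X) / L) - 2 * a * (X - r) * (e - X) / (L + 1) +
          a * L * (e - X) ^ 2 / (L + 1) ^ 2) := by
  have h1 : (X * L + e) / (L + 1) - r = (X - r) + (e - X) / (L + 1) := by
    field_simp
    ring
  have hdrift : b * κ * (Z - q) - (b * (κ + 1) + a) * (X - r) =
      b * (κ * Z - (κ + 1) * X) + a * (e - X) := by
    linarith
  rw [h1, hdrift]
  generalize X - r = Y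
  field_simp
  ring

theorem sq_drift_remainder_le {a b κ e L X Y Z : ℝ} (ha : 0 < a) (hb : 0 < b) (hk : 0 ≤ κ)
    (hL : 0 < L) (hX1 : X ≤ 1) (hZ1 : Z ≤ 1) (hY : |Y| ≤ 1) (heX : |e - X| ≤ 1) :
    b * ((κ * Z + (κ + 1) * X) / L) - 2 * a * Y * (e - X) / (L + 1) +
        a * L * (e - X) ^ 2 / (L + 1) ^ 2 ≤
      b * ((2 * κ + 1 + 3 * a / b) * L⁻¹) := by
  have h1 : (κ * Z + (κ + 1) * X) / L ≤ (2 * κ + 1) / L := by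
    refine div_le_div_of_nonneg_right ?_ hL.le
    nlinarith [mul_le_mul_of_nonneg_left hZ1 hk, mul_le_mul_of_nonneg_left hX1 hk]
  have h2 : -(2 * a * Y * (e - X) / (L + 1)) ≤ 2 * a / L := by
    have h3 : -(Y * (e - X)) ≤ 1 := by
      refine (neg_le_abs _).trans ?_
      rw [abs_mul]
      exact mul_le_one₀ hY (abs_nonneg _) heX
    calc -(2 * a * Y * (e - X) / (L + 1)) = 2 * a * -(Y * (e - X)) / (L + 1) := by ring
      _ ≤ 2 * a * 1 / (L + 1) := by gcongr
      _ ≤ 2 * a / L := by rw [mul_one]; gcongr; linarith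
  have h4 : a * L * (e - X) ^ 2 / (L + 1) ^ 2 ≤ a / L := by
    have h5 : (e - X) ^ 2 ≤ 1 := (sq_le_one_iff_abs_le_one _).2 heX
    calc a * L * (e - X) ^ 2 / (L + 1) ^ 2 ≤ a * L * 1 / L ^ 2 := by
          gcongr
          linarith
      _ = a / L := by field_simp
  calc _ ≤ b * ((2 * κ + 1) / L) + 2 * a / L + a / L := by
        linarith [mul_le_mul_of_nonneg_left h1 hb.le]
    _ = b * ((2 * κ + 1 + 3 * a / b) * L⁻¹) := by
        field_simp
        ring

theorem sq_drift_cross_le {a b κ W Y : ℝ} (ha : 0 ≤ a) (hb : 0 ≤ b) (hk : 0 ≤ κ) :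
    2 * Y * (b * κ * W - (b * (κ + 1) + a) * Y) ≤ -(a * Y ^ 2) + b * (κ * W ^ 2) := by
  nlinarith [mul_nonneg (mul_nonneg hb hk) (sq_nonneg (Y - W)), mul_nonneg ha (sq_nonneg Y),
    mul_nonneg hb (sq_nonneg Y), mul_nonneg (mul_nonneg hb hk) (sq_nonneg Y)]

theorem stepMean_sqDev_le {a b : ℝ} (ha : 0 < a) (hb : 0 < b) {t : ℕ} {x : List ℕ}
    (hx : IsReachable t x) {k : ℕ} {q r : ℝ} (hr0 : 0 ≤ r) (hr1 : r ≤ 1)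
    (hqr : ((k + 1) * b + a) * r = k * b * q + a * if k = 0 then 1 else 0) :
    stepMean a b (sqDev (k + 1) r) x ≤
      (1 - a / (a + b) / ((t : ℝ) + 1)) * sqDev (k + 1) r x +
        (k * sqDev k q x + (2 * k + 1 + 3 * a / b) * (x.length : ℝ)⁻¹) / ((t : ℝ) + 1) := by
  have hL : (1 : ℝ) ≤ x.length := by exact_mod_cast hx.length_pos
  have hLS : (x.length : ℝ) ≤ t + 1 := by exact_mod_cast hx.length_le
  rw [stepMean_sqDev_eq a b hx]
  have hN : (x.count (k + 1) : ℝ) ≤ x.length := by exact_mod_cast List.count_le_length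
  have hM : (x.count k : ℝ) ≤ x.length := by exact_mod_cast List.count_le_length
  have hN0 : (0 : ℝ) ≤ x.count (k + 1) := Nat.cast_nonneg _
  have hM0 : (0 : ℝ) ≤ x.count k := Nat.cast_nonneg _
  have hk : (0 : ℝ) ≤ k := Nat.cast_nonneg _
  have he0 : (0 : ℝ) ≤ if k = 0 then 1 else 0 := by split_ifs <;> norm_num
  have he1 : (if k = 0 then 1 else 0 : ℝ) ≤ 1 := by split_ifs <;> norm_num
  simp only [sqDev]
  generalize (if k = 0 then 1 else 0 : ℝ) = e at *
  generalize (k : ℝ) = κ at *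
  generalize (x.length : ℝ) = L at *
  generalize (t : ℝ) + 1 = S at *
  have hS0 : 0 < S := by linarith
  have hL0 : 0 < L := by linarith
  obtain ⟨X, hX⟩ : ∃ X, X = (x.count (k + 1) : ℝ) / L := ⟨_, rfl⟩
  obtain ⟨Z, hZ⟩ : ∃ Z, Z = (x.count k : ℝ) / L := ⟨_, rfl⟩
  have hXN : (x.count (k + 1) : ℝ) = X * L := by rw [hX]; field_simp
  have hZM : (x.count k : ℝ) = Z * L := by rw [hZ]; field_simp
  have hX0 : 0 ≤ X := hX ▸ by positivity
  have hX1 : X ≤ 1 := hX ▸ (div_le_one hL0).2 hN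
  have hZ0 : 0 ≤ Z := hZ ▸ by positivity
  have hZ1 : Z ≤ 1 := hZ ▸ (div_le_one hL0).2 hM
  rw [← hX, ← hZ, hXN, hZM]
  clear hX hZ hXN hZM hN hM hN0 hM0
  have hD : 0 < b * S + L * a := by positivity
  have hbS : 0 < b * S := by positivity
  have hYabs : |X - r| ≤ 1 := abs_le.2 ⟨by linarith, by linarith⟩
  have heX : |e - X| ≤ 1 := abs_le.2 ⟨by linarith, by linarith⟩
  have hR := sq_drift_remainder_le ha hb hk hL0 hX1 hZ1 hYabs heX
  have hcross := sq_drift_cross_le (W := Z - q) (Y := X - r) ha.le hb.le hk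
  rw [sq_drift_eq hL0 hqr]
  generalize b * ((κ * Z + (κ + 1) * X) / L) - 2 * a * (X - r) * (e - X) / (L + 1) +
    a * L * (e - X) ^ 2 / (L + 1) ^ 2 = R at *
  generalize 2 * (X - r) * (b * κ * (Z - q) - (b * (κ + 1) + a) * (X - r)) = Q at *
  have hE0 : 0 ≤ κ * (Z - q) ^ 2 + (2 * κ + 1 + 3 * a / b) * L⁻¹ := by positivity
  have hRQ : R + Q ≤ b * (κ * (Z - q) ^ 2 + (2 * κ + 1 + 3 * a / b) * L⁻¹) -
      a * (X - r) ^ 2 := by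
    rw [mul_add]
    linarith
  generalize κ * (Z - q) ^ 2 + (2 * κ + 1 + 3 * a / b) * L⁻¹ = E at *
  have hV : 0 ≤ (X - r) ^ 2 := sq_nonneg _
  generalize (X - r) ^ 2 = V at *
  have h1 : a / (a + b) / S * V ≤ a * V / (b * S + L * a) := by
    rw [div_div, div_mul_eq_mul_div]
    refine div_le_div_of_nonneg_left (by positivity) hD ?_
    linarith [mul_le_mul_of_nonneg_right hLS ha.le]
  have h2 : b * E / (b * S + L * a) ≤ E / S := by
    rw [← mul_div_mul_left E S hb.ne']
    refine div_le_div_of_nonneg_left (by positivity) hbS ?_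
    linarith [mul_pos hL0 ha]
  calc ((b * S + L * a) * V + Q + R) / (b * S + L * a)
      ≤ ((b * S + L * a) * V - a * V + b * E) / (b * S + L * a) :=
        div_le_div_of_nonneg_right (by linarith) hD.le
    _ = V - a * V / (b * S + L * a) + b * E / (b * S + L * a) := by
        rw [add_div, sub_div, mul_div_cancel_left₀ _ hD.ne']
    _ ≤ (1 - a / (a + b) / S) * V + E / S := by linarith

/-! ### Convergence -/

theorem tendsto_chainMean_inv_length {a b : ℝ} (ha : 0 < a) (hb : 0 < b) :
    Tendsto (fun t => chainMean a b t fun x => (x.length : ℝ)⁻¹) atTop (𝓝 0) := by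
  refine tendsto_zero_of_harmonic_contraction (ε := fun _ => 0) (c := a / (2 * (a + b)))
    (by positivity) ((div_le_one (by positivity)).2 (by linarith))
    (fun t => chainMean_nonneg ha hb.le fun x _ => by positivity) tendsto_const_nhds fun t => ?_
  rw [zero_div, add_zero, ← chainMean_const_mul]
  exact chainMean_le ha.le hb.le fun x hx => stepMean_inv_length_le ha hb hx

theorem tendsto_chainMean_sqDev {a b : ℝ} (ha : 0 < a) (hb : 0 < b) {p : ℕ → ℝ} (hp0 : p 0 = 0)
    (hp : ∀ k : ℕ, ((k + 1) * b + a) * p (k + 1) = k * b * p k + a * if k = 0 then 1 else 0)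
    (j : ℕ) : Tendsto (fun t => chainMean a b t (sqDev j (p j))) atTop (𝓝 0) := by
  have hmem : ∀ k, 0 ≤ p k ∧ p k ≤ 1 := by
    intro k
    induction k with
    | zero => simp [hp0]
    | succ k ih =>
      have hk : (0 : ℝ) ≤ k := Nat.cast_nonneg _
      have he0 : (0 : ℝ) ≤ if k = 0 then 1 else 0 := by split_ifs <;> norm_num
      have he1 : (if k = 0 then 1 else 0 : ℝ) ≤ 1 := by split_ifs <;> norm_num
      have hpos : 0 < ((k : ℝ) + 1) * b + a := by positivity
      rw [eq_div_of_mul_eq hpos.ne' ((mul_comm _ _).trans (hp k))]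
      have := ih.1
      refine ⟨by positivity, (div_le_one hpos).2 ?_⟩
      nlinarith [mul_le_mul_of_nonneg_left ih.2 (mul_nonneg hk hb.le),
        mul_le_mul_of_nonneg_left he1 ha.le]
  induction j with
  | zero =>
    refine tendsto_const_nhds.congr fun t => ?_
    rw [chainMean_congr ha.le hb.le (g := fun _ => 0) fun x hx => by
      simp [sqDev, hp0, hx.count_zero], chainMean_const ha hb.le]
  | succ k ih =>
    have hε := (ih.const_mul (k : ℝ)).add
      ((tendsto_chainMean_inv_length ha hb).const_mul (2 * k + 1 + 3 * a / b))
    rw [mul_zero, mul_zero, add_zero] at hε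
    refine tendsto_zero_of_harmonic_contraction (c := a / (a + b)) (by positivity)
      ((div_le_one (by positivity)).2 (by linarith))
      (fun t => chainMean_nonneg ha hb.le fun x _ => sqDev_nonneg _ _ x) hε fun t => ?_
    have h := chainMean_le ha.le hb.le (t := t) fun x hx =>
      stepMean_sqDev_le ha hb hx (hmem (k + 1)).1 (hmem (k + 1)).2 (hp k)
    refine h.trans_eq ?_
    simp only [div_eq_mul_inv _ ((t : ℝ) + 1), mul_comm _ ((t : ℝ) + 1)⁻¹, chainMean_add,
      chainMean_const_mul]

theorem tendsto_inDegProb {a b : ℝ} (ha : 0 < a) (hb : 0 < b) {p : ℕ → ℝ} (hp0 : p 0 = 0)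
    (hp : ∀ k : ℕ, ((k + 1) * b + a) * p (k + 1) = k * b * p k + a * if k = 0 then 1 else 0)
    (j : ℕ) : Tendsto (fun t => inDegProb a b 0 t j) atTop (𝓝 (p j)) := by
  have h : Tendsto (fun t => (inDegProb a b 0 t j - p j) ^ 2) atTop (𝓝 0) := by
    refine squeeze_zero (fun t => sq_nonneg _) (fun t => ?_) (tendsto_chainMean_sqDev ha hb hp0 hp j)
    have h := sq_chainMean_le ha hb.le t fun x => (x.count j : ℝ) / x.length + -p j
    rw [chainMean_add, chainMean_const ha hb.le, ← inDegProb_eq_chainMean] at h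
    exact h
  rw [tendsto_iff_dist_tendsto_zero]
  simpa [Real.sqrt_sq_eq_abs, Real.dist_eq] using h.sqrt

/-- If `μ₂ = 0` then for every `j` the limit `p_j = lim_t P(d(V_t) = j)` exists,
`p_0 = 0` and `p_j = (λ₁/λ₂) B(j, 1 + λ₁/λ₂)` for `j ≥ 1`. -/
theorem limit_in_degree_distribution_no_detachment
    (lam1 lam2 mu2 : ℝ) (hlam1 : 0 < lam1) (hlam2 : 0 < lam2) (hmu2 : mu2 = 0) :
    Tendsto (fun t => inDegProb lam1 lam2 mu2 t 0) atTop (𝓝 0) ∧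
    ∀ j : ℕ, 1 ≤ j →
      Tendsto (fun t => inDegProb lam1 lam2 mu2 t j) atTop
        (𝓝 (lam1 / lam2 * betaFn j (1 + lam1 / lam2))) := by
  subst hmu2
  set p : ℕ → ℝ := fun j => if j = 0 then 0 else lam1 / lam2 * betaFn j (1 + lam1 / lam2) with hpdef
  have hp : ∀ k : ℕ, ((k + 1) * lam2 + lam1) * p (k + 1) =
      k * lam2 * p k + lam1 * if k = 0 then 1 else 0 := by
    have hpos : 0 < 1 + lam1 / lam2 := by positivity
    intro k
    rcases Nat.eq_zero_or_pos k with rfl | hk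
    · have h := betaFn_one hpos
      simp only [hpdef, zero_add, one_ne_zero, if_false, if_true, Nat.cast_zero, Nat.cast_one]
      field_simp at h ⊢
      linear_combination lam1 * h
    · have h := betaFn_add_one (Nat.cast_pos.2 hk) hpos
      simp only [hpdef, k.succ_ne_zero, hk.ne', if_false, Nat.cast_add, Nat.cast_one]
      field_simp at h ⊢
      linear_combination h
  have hlim := tendsto_inDegProb hlam1 hlam2 (p := p) (if_pos rfl) hp
  refine ⟨by simpa [hpdef] using hlim 0, fun j hj => ?_⟩
  have h := hlim j
  simp only [hpdef, if_neg (Nat.one_le_iff_ne_zero.1 hj)] at h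
  exact h
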